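/- Let d be a positive integer and let Ω ⊆ ℝ^d be a locally compact set. Then for a typical function f ∈ C(Ω) there is a partition Ω = A ∪ B (A and B disjoint) such that the lower packing dimension of A is at most d−1 and the Hausdorff dimension of f(B) is 0. -/

import Mathlib

open Filter Set Topology MeasureTheory
open scoped ENNReal NNReal

noncomputable section

/-- A gauge: nondecreasing on `[0,∞)`, right-continuous, `φ 0 = 0`, positive on `(0,∞)`. -/
def IsGauge (φ : ℝ → ℝ) : Prop :=
  (∀ ⦃a b : ℝ⦄, 0 ≤ a → a ≤ b → φ a ≤ φ b) ∧
  (∀ a : ℝ, 0 ≤ a → ContinuousWithinAt φ (Set.Ici a) a) ∧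
  φ 0 = 0 ∧ (∀ r : ℝ, 0 < r → 0 < φ r)

/-- `N_δ(E)`: the least number of sets of diameter at most `δ` needed to cover `E`. -/
def coverNum {X : Type*} [PseudoMetricSpace X] (δ : ℝ) (E : Set X) : ℝ≥0∞ :=
  ⨅ (n : ℕ) (_ : ∃ F : Fin n → Set X,
    (∀ i, EMetric.diam (F i) ≤ ENNReal.ofReal δ) ∧ E ⊆ ⋃ i, F i), (n : ℝ≥0∞)

/-- `ν_0^ζ(E) = liminf_{δ→0+} N_δ(E)·ζ(δ)`. -/
def nu0 {X : Type*} [PseudoMetricSpace X] (ζ : ℝ → ℝ) (E : Set X) : ℝ≥0∞ :=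
  Filter.liminf (fun δ : ℝ => coverNum δ E * ENNReal.ofReal (ζ δ)) (𝓝[>] (0:ℝ))

/-- The lower box-counting measure `ν^ζ`. -/
def lowerBoxMeasure {X : Type*} [PseudoMetricSpace X] (ζ : ℝ → ℝ) (E : Set X) : ℝ≥0∞ :=
  ⨅ (G : ℕ → Set X) (_ : E ⊆ ⋃ n, G n), ∑' n, nu0 ζ (G n)

/-- The lower box dimension `lbdim E = liminf_{r→0+} log N_r(E)/|log r|`. -/
def lbdim {X : Type*} [PseudoMetricSpace X] (E : Set X) : EReal :=
  Filter.liminf (fun r : ℝ => ENNReal.log (coverNum r E) * ((|Real.log r|⁻¹ : ℝ) : EReal))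
    (𝓝[>] (0:ℝ))

/-- The lower packing dimension. -/
def lpdim {X : Type*} [PseudoMetricSpace X] (E : Set X) : EReal :=
  ⨅ (G : ℕ → Set X) (_ : E ⊆ ⋃ n, G n), ⨆ n, lbdim (G n)

/-- The generalized lower scaled oscillation `lip_φ f`. -/
def lipGauge {X : Type*} [PseudoMetricSpace X] (φ : ℝ → ℝ) (f : X → ℝ) (x : X) : ℝ≥0∞ :=
  Filter.liminf
    (fun r : ℝ => EMetric.diam (f '' Metric.closedBall x r) / ENNReal.ofReal (φ r))
    (𝓝[>] (0:ℝ))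

/-- The upper scaled oscillation `Lip f`. -/
def LipGauge {X : Type*} [PseudoMetricSpace X] (φ : ℝ → ℝ) (f : X → ℝ) (x : X) : ℝ≥0∞ :=
  Filter.limsup
    (fun r : ℝ => EMetric.diam (f '' Metric.closedBall x r) / ENNReal.ofReal (φ r))
    (𝓝[>] (0:ℝ))

/-- The Hausdorff measure with gauge `ξ`. -/
def hausdorffGauge {X : Type*} [PseudoMetricSpace X] (ξ : ℝ → ℝ) (E : Set X) : ℝ≥0∞ :=
  ⨆ (δ : ℝ) (_ : 0 < δ), ⨅ (G : ℕ → Set X) (_ : E ⊆ ⋃ n, G n)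
    (_ : ∀ n, EMetric.diam (G n) ≤ ENNReal.ofReal δ),
    ∑' n, ENNReal.ofReal (ξ (EMetric.diam (G n)).toReal)

/-- A box in `ℝ^k`. -/
def IsBox {k : ℕ} (S : Set (EuclideanSpace ℝ (Fin k))) : Prop :=
  ∃ a b : Fin k → ℝ, S = {x | ∀ i, x i ∈ Set.Icc (a i) (b i)}

/-- A microscopic subset of `ℝ^k`. -/
def Microscopic {k : ℕ} (X : Set (EuclideanSpace ℝ (Fin k))) : Prop :=
  ∀ ε : ℝ, 0 < ε → ∃ B : ℕ → Set (EuclideanSpace ℝ (Fin k)),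
    (∀ n, IsBox (B n)) ∧ X ⊆ ⋃ n, B n ∧
    ∀ n, MeasureTheory.volume (B n) ≤ ENNReal.ofReal (ε ^ (n + 1))

/-- A microscopic subset of `ℝ`. -/
def MicroscopicR (E : Set ℝ) : Prop :=
  ∀ ε : ℝ, 0 < ε → ∃ I : ℕ → ℝ × ℝ,
    E ⊆ ⋃ n, Set.Icc (I n).1 (I n).2 ∧
    ∀ n, MeasureTheory.volume (Set.Icc (I n).1 (I n).2) ≤ ENNReal.ofReal (ε ^ (n + 1))

end

/-- Covering numbers are bounded by the cardinality of any finite indexed cover. -/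
theorem coverNum_le_card {X ι : Type*} [PseudoMetricSpace X] {δ : ℝ} {E : Set X} (s : Finset ι)
    (F : ι → Set X) (hF : ∀ i ∈ s, Metric.ediam (F i) ≤ ENNReal.ofReal δ)
    (hE : E ⊆ ⋃ i ∈ s, F i) : coverNum δ E ≤ s.card := by
  refine iInf₂_le_of_le s.card ⟨fun j => F (s.equivFin.symm j), fun j => hF _ (by simp), ?_⟩ le_rfl
  intro x hx
  obtain ⟨i, hi, hxi⟩ := mem_iUnion₂.1 (hE hx)
  exact mem_iUnion.2 ⟨s.equivFin ⟨i, hi⟩, by simpa using hxi⟩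

theorem coverNum_mono {X : Type*} [PseudoMetricSpace X] {δ : ℝ} {E E' : Set X} (h : E ⊆ E') :
    coverNum δ E ≤ coverNum δ E' :=
  le_iInf₂ fun n ⟨F, hF, hE⟩ => iInf₂_le n ⟨F, hF, h.trans hE⟩

theorem lbdim_le_of_frequently {X : Type*} [PseudoMetricSpace X] {E : Set X} {a : ℝ}
    (h : ∃ᶠ r in 𝓝[>] (0 : ℝ), coverNum r E ≤ ENNReal.ofReal (Real.exp (a * |Real.log r|))) :
    lbdim E ≤ a := by
  refine liminf_le_of_frequently_le' ?_
  have h1 : ∀ᶠ r in 𝓝[>] (0 : ℝ), r ∈ Ioo (0 : ℝ) 1 := Ioo_mem_nhdsGT one_pos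
  refine (h.and_eventually h1).mono fun r ⟨hr, h0, h1⟩ => ?_
  have hl : 0 < |Real.log r| := abs_pos.2 (Real.log_neg h0 h1).ne
  have h2 : ENNReal.log (coverNum r E) ≤ ((a * |Real.log r| : ℝ) : EReal) := by
    have := ENNReal.log_le_log hr
    rwa [ENNReal.log_ofReal_of_pos (Real.exp_pos _), Real.log_exp] at this
  calc _ ≤ ((a * |Real.log r| : ℝ) : EReal) * ((|Real.log r|⁻¹ : ℝ) : EReal) :=
        mul_le_mul_of_nonneg_right h2 (by exact_mod_cast (inv_pos.2 hl).le)
    _ = a := by rw [← EReal.coe_mul, mul_assoc, mul_inv_cancel₀ hl.ne', mul_one]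

/-- If covers at arbitrarily small scales have exponents tending to `D`, then `lbdim E ≤ D`. -/
theorem lbdim_le_of_forall_exists {X : Type*} [PseudoMetricSpace X] {E : Set X} {D : ℝ}
    (h : ∀ ε > 0, ∃ r ∈ Ioo 0 ε,
      coverNum r E ≤ ENNReal.ofReal (Real.exp ((D + ε) * |Real.log r|))) :
    lbdim E ≤ D := by
  refine le_of_forall_gt_imp_ge_of_dense fun c hc => ?_
  obtain ⟨a, hDa, hac⟩ := EReal.lt_iff_exists_real_btwn.1 hc
  refine (lbdim_le_of_frequently ?_).trans hac.le
  rw [(nhdsGT_basis (0 : ℝ)).frequently_iff]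
  intro δ hδ
  have hDa' : D < a := by exact_mod_cast hDa
  obtain ⟨r, hr, hcov⟩ := h (min δ (a - D)) (lt_min hδ (by linarith))
  refine ⟨r, ⟨hr.1, hr.2.trans_le (min_le_left _ _)⟩, hcov.trans ?_⟩
  gcongr
  have := min_le_right δ (a - D)
  linarith

/-- The part of the cube `[-R, R]^d` lying in the slabs of relative width `1 / m` along the
hyperplanes of the grid of mesh `1 / k`. -/
def wall (d R k m : ℕ) : Set (EuclideanSpace ℝ (Fin d)) :=
  {x | (∀ j, |x j| ≤ R) ∧ ∃ i, 1 - 1 / (m : ℝ) ≤ Int.fract (k * x i)}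

theorem coverNum_wall_le {d R k m : ℕ} (hR : 0 < R) (hk : 0 < k) (hm : 0 < m) :
    coverNum ((d : ℝ) / (m * k)) (wall d R k m) ≤
      (d * (3 * k * R) * (3 * (m * k) * R) ^ (d - 1) : ℕ) := by
  classical
  set S : Finset ℤ := Finset.Icc (-(m * k * R : ℤ)) (m * k * R) with hS
  set T : Finset ℤ := (Finset.Icc (-(k * R : ℤ)) (k * R)).image fun a => m * a + (m - 1) with hT
  set P : Fin d → Finset (Fin d → ℤ) := fun i =>
    Fintype.piFinset (Function.update (fun _ => S) i T) with hP
  have hm' : (0 : ℝ) < m := by exact_mod_cast hm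
  have hk' : (0 : ℝ) < k := by exact_mod_cast hk
  have hRpos : 0 < k * R := by positivity
  have hRpos' : 0 < m * k * R := by positivity
  have hScard : S.card ≤ 3 * (m * k) * R := by
    have h1 : S.card = 2 * (m * k * R) + 1 := by
      rw [hS, Int.card_Icc]
      have : ((m * k * R : ℤ) + 1 - -(m * k * R)) = ((2 * (m * k * R) + 1 : ℕ) : ℤ) := by
        push_cast; ring
      rw [this, Int.toNat_natCast]
    rw [h1]; nlinarith
  have hTcard : T.card ≤ 3 * k * R := by
    refine Finset.card_image_le.trans ?_
    have h1 : (Finset.Icc (-(k * R : ℤ)) (k * R)).card = 2 * (k * R) + 1 := by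
      rw [Int.card_Icc]
      have : ((k * R : ℤ) + 1 - -(k * R)) = ((2 * (k * R) + 1 : ℕ) : ℤ) := by
        push_cast; ring
      rw [this, Int.toNat_natCast]
    rw [h1]; nlinarith
  have hPcard : ∀ i, (P i).card ≤ (3 * k * R) * (3 * (m * k) * R) ^ (d - 1) := by
    intro i
    rw [hP, Fintype.card_piFinset, ← Finset.mul_prod_erase _ _ (Finset.mem_univ i)]
    refine Nat.mul_le_mul (by simpa using hTcard) ?_
    calc _ ≤ ∏ j ∈ Finset.univ.erase i, 3 * (m * k) * R := by
          refine Finset.prod_le_prod' fun j hj => ?_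
          rw [Function.update_of_ne (Finset.ne_of_mem_erase hj)]
          exact hScard
      _ = _ := by simp [Finset.card_erase_of_mem]
  have hcard : (Finset.univ.biUnion P).card ≤
      d * (3 * k * R) * (3 * (m * k) * R) ^ (d - 1) := by
    refine (Finset.card_biUnion_le_card_mul _ _ _ fun i _ => hPcard i).trans ?_
    simp [mul_assoc]
  refine (coverNum_le_card (Finset.univ.biUnion P)
    (fun a => {x | ∀ j, ⌊(m : ℝ) * k * x j⌋ = a j}) ?_ ?_).trans (by exact_mod_cast hcard)
  · intro a _
    refine Metric.ediam_le fun x hx y hy => ?_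
    rw [edist_dist]
    refine ENNReal.ofReal_le_ofReal ?_
    have hxy : ∀ j, |x j - y j| ≤ 1 / (m * k) := by
      intro j
      have h1 := Int.abs_sub_lt_one_of_floor_eq_floor ((hx j).trans (hy j).symm)
      rw [← mul_sub, abs_mul, abs_of_pos (mul_pos hm' hk')] at h1
      rw [le_div_iff₀' (mul_pos hm' hk')]
      exact h1.le
    rw [EuclideanSpace.dist_eq]
    refine Real.sqrt_le_iff.2 ⟨by positivity, ?_⟩
    calc ∑ i, dist (x i) (y i) ^ 2 ≤ ∑ i : Fin d, (1 / (m * k : ℝ)) ^ 2 := by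
          gcongr with i
          exact hxy i
      _ = d * (1 / (m * k : ℝ)) ^ 2 := by simp
      _ ≤ (d : ℝ) ^ 2 * (1 / (m * k : ℝ)) ^ 2 := by
          gcongr
          exact_mod_cast Nat.le_self_pow two_ne_zero d
      _ = _ := by ring
  · rintro x ⟨hx, i, hi⟩
    refine mem_iUnion₂.2 ⟨fun j => ⌊(m : ℝ) * k * x j⌋, ?_, fun _ => rfl⟩
    have hfl : ∀ {N : ℕ} {j}, 0 < N →
        ⌊(N : ℝ) * x j⌋ ∈ Finset.Icc (-(N * R : ℤ)) (N * R) := by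
      intro N j hN
      have hN' : (0 : ℝ) < N := by exact_mod_cast hN
      have := abs_le.1 (hx j)
      rw [Finset.mem_Icc, Int.le_floor]
      refine ⟨by push_cast; nlinarith, ?_⟩
      have h1 := Int.floor_le ((N : ℝ) * x j)
      have : ((⌊(N : ℝ) * x j⌋ : ℤ) : ℝ) ≤ ((N * R : ℤ) : ℝ) := by push_cast; nlinarith
      exact_mod_cast this
    simp only [Finset.mem_biUnion, Finset.mem_univ, true_and]
    refine ⟨i, Fintype.mem_piFinset.2 fun j => ?_⟩
    by_cases hj : j = i
    · subst hj
      rw [Function.update_self, hT, Finset.mem_image]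
      refine ⟨⌊(k : ℝ) * x j⌋, hfl hk, ?_⟩
      symm
      rw [Int.floor_eq_iff]
      have h1 := Int.fract_lt_one ((k : ℝ) * x j)
      have h2 := Int.floor_add_fract ((k : ℝ) * x j)
      have h3 : (m : ℝ) * (1 - 1 / m) = m - 1 := by field_simp
      push_cast
      constructor
      · nlinarith
      · nlinarith
    · rw [Function.update_of_ne hj]
      have := hfl (N := m * k) (j := j) (by positivity)
      push_cast at this
      exact this

theorem exists_coverNum_wall_le {d R k : ℕ} (hd : 0 < d) (hR : 0 < R) (hk : 0 < k) {ε : ℝ}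
    (hε : 0 < ε) : ∃ m : ℕ, 0 < m ∧ ∃ r ∈ Ioo 0 ε, coverNum r (wall d R k m) ≤
      ENNReal.ofReal (Real.exp (((d - 1 : ℕ) + ε) * |Real.log r|)) := by
  have hd' : (0 : ℝ) < d := by exact_mod_cast hd
  have hk' : (0 : ℝ) < k := by exact_mod_cast hk
  have hlim : Tendsto (fun m : ℕ => (m : ℝ) * (k / d)) atTop atTop :=
    tendsto_natCast_atTop_atTop.atTop_mul_const (by positivity)
  set C : ℝ := d * (3 * k * R) * (3 * d * R) ^ (d - 1) with hC
  have hexp : Tendsto (fun m : ℕ => ((m : ℝ) * (k / d)) ^ ε) atTop atTop :=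
    (tendsto_rpow_atTop hε).comp hlim
  obtain ⟨m, hm, hm1, hmε, hmC⟩ := ((eventually_gt_atTop 0).and
    ((hlim.eventually_gt_atTop 1).and ((hlim.eventually_gt_atTop (1 / ε)).and
      (hexp.eventually_ge_atTop C)))).exists
  have hm' : (0 : ℝ) < m := by exact_mod_cast hm
  set q : ℝ := m * (k / d) with hq
  have hq0 : 0 < q := by positivity
  have hr : (d : ℝ) / (m * k) = q⁻¹ := by rw [hq]; field_simp
  refine ⟨m, hm, d / (m * k), ⟨by positivity, ?_⟩, ?_⟩
  · rw [hr]; exact inv_lt_of_inv_lt₀ hε (by simpa using hmε)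
  · refine (coverNum_wall_le hR hk hm).trans ?_
    rw [← ENNReal.ofReal_natCast]
    refine ENNReal.ofReal_le_ofReal ?_
    rw [hr, Real.log_inv, abs_neg, abs_of_pos (Real.log_pos hm1), mul_comm _ (Real.log q),
      ← Real.rpow_def_of_pos hq0, Real.rpow_add hq0, Real.rpow_natCast]
    have h1 : (3 * ((m : ℝ) * k) * R) = q * (3 * d * R) := by rw [hq]; field_simp
    push_cast
    rw [h1, mul_pow]
    calc _ = q ^ (d - 1) * C := by rw [hC]; ring
      _ ≤ _ := by gcongr

/-- A continuous perturbation of the identity of `ℝ` which agrees with the floor function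
wherever the fractional part is at most `1 - 1 / m`. -/
noncomputable def plateau (m : ℕ) (t : ℝ) : ℝ :=
  t + (max 0 (m * (Int.fract t - 1) + 1) - Int.fract t)

theorem continuous_plateau (m : ℕ) (hm : 0 < m) : Continuous (plateau m) := by
  have h1 : (1 : ℝ) ≤ m := by exact_mod_cast hm
  have : Continuous ((fun u : ℝ => max 0 (m * (u - 1) + 1) - u) ∘ Int.fract) := by
    refine ContinuousOn.comp_fract'' (by fun_prop) ?_
    simp only [sub_self, mul_zero, zero_add, sub_zero]
    rw [max_eq_left (by linarith), max_eq_right zero_le_one, sub_self]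
  exact continuous_id.add this

theorem abs_plateau_sub_le (m : ℕ) (t : ℝ) : |plateau m t - t| ≤ 1 := by
  have h0 := Int.fract_nonneg t
  have h1 := Int.fract_lt_one t
  have h2 : max 0 (m * (Int.fract t - 1) + 1) ≤ 1 :=
    max_le zero_le_one (by nlinarith [Nat.cast_nonneg (α := ℝ) m])
  have h3 := le_max_left 0 (m * (Int.fract t - 1) + 1)
  rw [plateau, add_sub_cancel_left, abs_le]
  constructor <;> linarith

theorem plateau_eq_floor {m : ℕ} (hm : 0 < m) {t : ℝ} (ht : Int.fract t ≤ 1 - 1 / m) :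
    plateau m t = ⌊t⌋ := by
  have hm' : (0 : ℝ) < m := by exact_mod_cast hm
  have h3 : (m : ℝ) * (1 - 1 / m) = m - 1 := by field_simp
  rw [plateau, max_eq_left (by nlinarith)]
  linarith [Int.floor_add_fract t]

/-- Outside a set with few covers at one scale below `ε`, the values of `f` on `K` lie in a finite
union of intervals of very small `ε`-dimensional size. -/
def NearlyFinite {d : ℕ} {Ω : Set (EuclideanSpace ℝ (Fin d))} (K : Set Ω) (ε : ℝ) (η : ℝ≥0∞)
    (f : C(Ω, ℝ)) : Prop :=
  ∃ W : Set (EuclideanSpace ℝ (Fin d)),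
    (∃ r ∈ Ioo 0 ε, coverNum r W ≤
      ENNReal.ofReal (Real.exp (((d - 1 : ℕ) + ε) * |Real.log r|))) ∧
    ∃ (F : Finset ℝ) (ρ : ℝ), ENNReal.ofReal (2 * ρ) ≤ η ∧
      F.card * ENNReal.ofReal (2 * ρ) ^ ε ≤ η ∧
      ∀ x ∈ K, (x : EuclideanSpace ℝ (Fin d)) ∉ W → ∃ y ∈ F, f x ∈ Metric.closedBall y ρ

theorem exists_radius (N : ℕ) {ε : ℝ} (hε : 0 < ε) {η : ℝ≥0∞} (hη : 0 < η) :
    ∃ ρ : ℝ, 0 < ρ ∧ ENNReal.ofReal (2 * ρ) ≤ η ∧ N * ENNReal.ofReal (2 * ρ) ^ ε ≤ η := by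
  have h1 : Tendsto (fun ρ : ℝ => ENNReal.ofReal (2 * ρ)) (𝓝[>] 0) (𝓝 0) := by
    have : Continuous fun ρ : ℝ => ENNReal.ofReal (2 * ρ) :=
      ENNReal.continuous_ofReal.comp (by fun_prop)
    simpa using (this.tendsto 0).mono_left nhdsWithin_le_nhds
  have h2 : Tendsto (fun ρ : ℝ => N * ENNReal.ofReal (2 * ρ) ^ ε) (𝓝[>] 0) (𝓝 0) := by
    have := ENNReal.Tendsto.const_mul (a := (N : ℝ≥0∞))
      (((ENNReal.continuous_rpow_const (y := ε)).tendsto 0).comp h1)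
      (Or.inr (ENNReal.natCast_ne_top N))
    simpa [ENNReal.zero_rpow_of_pos hε] using this
  obtain ⟨ρ, h0, h3, h4⟩ := ((eventually_mem_nhdsWithin (a := (0 : ℝ)) (s := Ioi 0)).and
    ((h1.eventually (ge_mem_nhds hη)).and (h2.eventually (ge_mem_nhds hη)))).exists
  exact ⟨ρ, h0, h3, h4⟩

/-- Every continuous function is approximated on `K` by one which takes finitely many values on
`L` outside a wall. -/
theorem exists_approx {d : ℕ} (hd : 0 < d) {Ω : Set (EuclideanSpace ℝ (Fin d))} {K L : Set Ω}
    (hK : IsCompact K) (hL : IsCompact L) (g : C(Ω, ℝ)) {δ ε : ℝ} (hδ : 0 < δ) (hε : 0 < ε) :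
    ∃ h : C(Ω, ℝ), (∀ x ∈ K, dist (g x) (h x) < δ) ∧
      ∃ W : Set (EuclideanSpace ℝ (Fin d)),
        (∃ r ∈ Ioo 0 ε, coverNum r W ≤
          ENNReal.ofReal (Real.exp (((d - 1 : ℕ) + ε) * |Real.log r|))) ∧
        ∃ F : Finset ℝ, ∀ x ∈ L, (x : EuclideanSpace ℝ (Fin d)) ∉ W → h x ∈ F := by
  classical
  set K' : Set (EuclideanSpace ℝ (Fin d)) := Subtype.val '' K with hK'
  have hK'c : IsCompact K' := hK.image continuous_subtype_val
  obtain ⟨R, hR, hRL⟩ : ∃ R : ℕ, 0 < R ∧ ∀ x ∈ L, ∀ j, |(x : EuclideanSpace ℝ (Fin d)) j| ≤ R := by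
    obtain ⟨C, hC⟩ := (hL.image continuous_subtype_val).isBounded.exists_norm_le
    obtain ⟨R, hR⟩ := exists_nat_ge C
    refine ⟨R + 1, R.succ_pos, fun x hx j => ?_⟩
    have h1 := hC _ (mem_image_of_mem _ hx)
    have h2 := PiLp.norm_apply_le (x : EuclideanSpace ℝ (Fin d)) j
    rw [Real.norm_eq_abs] at h2
    push_cast
    linarith
  have hK'Ω : ∀ x : K', (x : EuclideanSpace ℝ (Fin d)) ∈ Ω := by
    rintro ⟨_, y, -, rfl⟩; exact y.2
  obtain ⟨G, hG⟩ := ContinuousMap.exists_restrict_eq hK'c.isClosed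
    (g.comp ⟨fun x : K' => (⟨x, hK'Ω x⟩ : Ω), by fun_prop⟩)
  have hGg : ∀ x ∈ K, G (x : EuclideanSpace ℝ (Fin d)) = g x := by
    intro x hx
    exact DFunLike.congr_fun hG ⟨x, mem_image_of_mem _ hx⟩
  obtain ⟨δ', hδ', hunif⟩ := Metric.mem_uniformity_dist.1
    (hK'c.uniformContinuousAt_of_continuousAt G (fun a _ => G.continuous.continuousAt)
      (Metric.dist_mem_uniformity hδ))
  obtain ⟨k, hk⟩ := exists_nat_gt (d / δ')
  have hd' : (0 : ℝ) < d := by exact_mod_cast hd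
  have hk' : (0 : ℝ) < k := lt_trans (by positivity) hk
  have hk0 : 0 < k := by exact_mod_cast hk'
  obtain ⟨m, hm, hcov⟩ := exists_coverNum_wall_le hd hR hk0 hε
  let π : C(EuclideanSpace ℝ (Fin d), EuclideanSpace ℝ (Fin d)) :=
    ⟨fun x => WithLp.toLp 2 fun i => plateau m (k * x i) / k, by
      have := continuous_plateau m hm
      fun_prop⟩
  have hπ : ∀ x, dist x (π x) < δ' := by
    intro x
    have h1 : ∀ i, dist (x i) (π x i) ≤ 1 / k := by
      intro i
      have h2 := abs_plateau_sub_le m (k * x i)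
      have h3 : x i - π x i = -((plateau m (k * x i) - k * x i) / k) := by
        simp only [π, ContinuousMap.coe_mk]
        field_simp
        ring
      rw [Real.dist_eq, h3, abs_neg, abs_div, abs_of_pos hk']
      gcongr
    have h2 : dist x (π x) ≤ d / k := by
      rw [EuclideanSpace.dist_eq]
      refine Real.sqrt_le_iff.2 ⟨by positivity, ?_⟩
      calc ∑ i, dist (x i) (π x i) ^ 2 ≤ ∑ i : Fin d, (1 / (k : ℝ)) ^ 2 := by
            gcongr with i
            exact h1 i
        _ = d * (1 / (k : ℝ)) ^ 2 := by simp
        _ ≤ (d : ℝ) ^ 2 * (1 / (k : ℝ)) ^ 2 := by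
            gcongr
            exact_mod_cast Nat.le_self_pow two_ne_zero d
        _ = _ := by ring
    refine h2.trans_lt ?_
    rw [div_lt_iff₀ hk']
    rwa [div_lt_iff₀' hδ'] at hk
  refine ⟨(G.comp π).comp ⟨Subtype.val, continuous_subtype_val⟩, ?_, wall d R k m, hcov,
    (Fintype.piFinset fun _ : Fin d => Finset.Icc (-(k * R : ℤ)) (k * R)).image
      fun a => G (WithLp.toLp 2 fun i => (a i : ℝ) / k), ?_⟩
  · intro x hx
    rw [← hGg x hx]
    exact hunif (hπ x) (mem_image_of_mem _ hx)
  · intro x hx hxW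
    have hfr : ∀ i, Int.fract (k * (x : EuclideanSpace ℝ (Fin d)) i) ≤ 1 - 1 / m := by
      by_contra! hcon
      obtain ⟨i, hi⟩ := hcon
      exact hxW ⟨hRL x hx, i, hi.le⟩
    refine Finset.mem_image.2 ⟨fun i => ⌊k * (x : EuclideanSpace ℝ (Fin d)) i⌋, ?_, ?_⟩
    · refine Fintype.mem_piFinset.2 fun j => ?_
      have := abs_le.1 (hRL x hx j)
      rw [Finset.mem_Icc, Int.le_floor]
      refine ⟨by push_cast; nlinarith, ?_⟩
      have h1 := Int.floor_le ((k : ℝ) * (x : EuclideanSpace ℝ (Fin d)) j)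
      have : ((⌊(k : ℝ) * (x : EuclideanSpace ℝ (Fin d)) j⌋ : ℤ) : ℝ) ≤ ((k * R : ℤ) : ℝ) := by
        push_cast; nlinarith
      exact_mod_cast this
    · simp only [ContinuousMap.comp_apply, ContinuousMap.coe_mk, π]
      congr 2
      funext i
      rw [plateau_eq_floor hm (hfr i)]

theorem eventually_residual_nearlyFinite {d : ℕ} (hd : 0 < d)
    {Ω : Set (EuclideanSpace ℝ (Fin d))} {L : Set Ω} (hL : IsCompact L) {ε : ℝ} (hε : 0 < ε)
    {η : ℝ≥0∞} (hη : 0 < η) : ∀ᶠ f in residual C(Ω, ℝ), NearlyFinite L ε η f := by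
  refine mem_of_superset (residual_of_dense_open isOpen_interior ?_)
    (interior_subset (s := {f | NearlyFinite L ε η f}))
  have hbasis := fun g : C(Ω, ℝ) => nhds_basis_uniformity'
    (Metric.uniformity_basis_dist.compactConvergenceUniformity (α := Ω)) (x := g)
  intro g
  rw [mem_closure_iff_nhds_basis (hbasis g)]
  rintro ⟨K, δ⟩ ⟨hK, hδ⟩
  obtain ⟨h, hgh, W, hW, F, hF⟩ := exists_approx hd hK hL g hδ hε
  obtain ⟨ρ, hρ, hρ1, hρ2⟩ := exists_radius F.card hε hη
  refine ⟨h, mem_interior_iff_mem_nhds.2 ?_, hgh⟩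
  refine mem_of_superset ((hbasis h).mem_of_mem (i := (L, ρ)) ⟨hL, hρ⟩) fun f hf => ?_
  refine ⟨W, hW, F, ρ, hρ1, hρ2, fun x hx hxW => ⟨h x, hF x hx hxW, ?_⟩⟩
  rw [Metric.mem_closedBall, dist_comm]
  exact (hf x hx).le

/-- A set which for every `N` is covered by the union over `n ≥ N` of the `ρ n`-balls around the
finite sets `F n` has dimension zero, provided the balls shrink fast enough. -/
theorem dimH_eq_zero_of_cover {E : Set ℝ} {F : ℕ → Finset ℝ} {ρ : ℕ → ℝ}
    (hρ : ∀ n, ENNReal.ofReal (2 * ρ n) ≤ 2⁻¹ ^ n)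
    (hF : ∀ n, (F n).card * ENNReal.ofReal (2 * ρ n) ^ (1 / ((n : ℝ) + 1)) ≤ 2⁻¹ ^ n)
    (hE : ∀ y ∈ E, ∀ N, ∃ n ≥ N, ∃ c ∈ F n, y ∈ Metric.closedBall c (ρ n)) : dimH E = 0 := by
  have hpow : Tendsto (fun n : ℕ => (2⁻¹ : ℝ≥0∞) ^ n) atTop (𝓝 0) :=
    ENNReal.tendsto_pow_atTop_nhds_zero_of_lt_one (by simp)
  have hanti : ∀ N n : ℕ, (2⁻¹ : ℝ≥0∞) ^ (n + N) ≤ 2⁻¹ ^ N := fun N n =>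
    pow_le_pow_right_of_le_one' (by simp) (Nat.le_add_left N n)
  have hdiam : ∀ (n : ℕ) (c : ℝ),
      Metric.ediam (Metric.closedBall c (ρ n)) ≤ ENNReal.ofReal (2 * ρ n) := by
    intro n c
    refine Metric.ediam_le fun x hx y hy => ?_
    rw [edist_dist]
    refine ENNReal.ofReal_le_ofReal ?_
    have := dist_triangle_right x y c
    rw [Metric.mem_closedBall] at hx hy
    linarith
  have key : ∀ t : ℝ≥0, 0 < t → μH[t] E = 0 := by
    intro t ht
    have ht' : (0 : ℝ) < t := by exact_mod_cast ht
    refine le_antisymm ?_ zero_le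
    refine (Measure.hausdorffMeasure_le_liminf_tsum (ι := fun N : ℕ => Σ n : ℕ, F (n + N)) (t : ℝ) E
      (l := atTop) (fun N => 2⁻¹ ^ N) hpow
      (fun N p => Metric.closedBall (p.2 : ℝ) (ρ (p.1 + N))) ?_ ?_).trans ?_
    · exact Eventually.of_forall fun N p => (hdiam _ _).trans ((hρ _).trans (hanti _ _))
    · refine Eventually.of_forall fun N y hy => ?_
      obtain ⟨n, hn, c, hc, hyc⟩ := hE y hy N
      obtain ⟨n, rfl⟩ := Nat.exists_eq_add_of_le' hn
      exact mem_iUnion.2 ⟨⟨n, c, hc⟩, hyc⟩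
    · have hlim : Tendsto (fun N : ℕ => 2 * (2⁻¹ : ℝ≥0∞) ^ N) atTop (𝓝 0) := by
        simpa using ENNReal.Tendsto.const_mul hpow (Or.inr (by simp))
      rw [← hlim.liminf_eq]
      obtain ⟨N₀, hN₀⟩ := exists_nat_gt (1 / (t : ℝ))
      refine liminf_le_liminf ?_
      filter_upwards [eventually_ge_atTop N₀] with N hN
      rw [ENNReal.tsum_sigma']
      calc _ ≤ ∑' n : ℕ, (2⁻¹ : ℝ≥0∞) ^ (n + N) := by
            refine ENNReal.tsum_le_tsum fun n => ?_
            refine le_trans ?_ (hF (n + N))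
            rw [tsum_fintype]
            calc _ ≤ ∑ c : F (n + N),
                  ENNReal.ofReal (2 * ρ (n + N)) ^ (1 / (((n + N : ℕ) : ℝ) + 1)) := by
                  refine Finset.sum_le_sum fun c _ => ?_
                  refine (ENNReal.rpow_le_rpow (hdiam _ _) ht'.le).trans ?_
                  refine ENNReal.rpow_le_rpow_of_exponent_ge
                    ((hρ _).trans (pow_le_one' (by simp) _)) ?_
                  rw [div_le_iff₀ (by positivity)]
                  rw [div_lt_iff₀ ht'] at hN₀
                  have : (N₀ : ℝ) ≤ (n + N : ℕ) := by exact_mod_cast hN.trans (Nat.le_add_left N n)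
                  nlinarith
              _ = _ := by simp
        _ = 2 * 2⁻¹ ^ N := by
            simp_rw [pow_add]
            rw [ENNReal.tsum_mul_right, ENNReal.tsum_geometric]
            simp
  refine le_antisymm (le_of_forall_gt_imp_ge_of_dense fun c hc => ?_) zero_le
  obtain ⟨t, ht0, htc⟩ := ENNReal.lt_iff_exists_nnreal_btwn.1 hc
  refine le_trans (dimH_le_of_hausdorffMeasure_ne_top ?_) htc.le
  rw [key t (by exact_mod_cast ht0)]
  exact ENNReal.zero_ne_top

theorem stmt7
    (d : ℕ) (hd : 0 < d) (Ω : Set (EuclideanSpace ℝ (Fin d)))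
    (hΩ : LocallyCompactSpace Ω) :
    ∀ᶠ f : C(↥Ω, ℝ) in residual C(↥Ω, ℝ),
      ∃ A B : Set (EuclideanSpace ℝ (Fin d)),
        A ∪ B = Ω ∧ Disjoint A B ∧
        lpdim A ≤ ((d - 1 : ℕ) : EReal) ∧
        dimH (⇑f '' {x : ↥Ω | (x : EuclideanSpace ℝ (Fin d)) ∈ B}) = 0 := by
  let K : CompactExhaustion Ω := default
  have hev : ∀ᶠ f in residual C(Ω, ℝ), ∀ n : ℕ,
      NearlyFinite (K n) (1 / ((n : ℝ) + 1)) (2⁻¹ ^ n) f :=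
    eventually_countable_forall.2 fun n =>
      eventually_residual_nearlyFinite hd (K.isCompact n) (by positivity)
        (ENNReal.pow_pos (by simp) n)
  filter_upwards [hev] with f hf
  choose W hW F ρ hρ hFρ hcov using hf
  refine ⟨Ω ∩ ⋃ k, ⋂ n ≥ k, W n, Ω \ ⋃ k, ⋂ n ≥ k, W n, inter_union_sdiff _ _,
    disjoint_sdiff_inter.symm, ?_, dimH_eq_zero_of_cover hρ hFρ ?_⟩
  · refine iInf₂_le_of_le (fun k => ⋂ n ≥ k, W n) inter_subset_right (iSup_le fun k => ?_)
    have : lbdim (⋂ n ≥ k, W n) ≤ (((d - 1 : ℕ) : ℝ) : EReal) := by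
      refine lbdim_le_of_forall_exists fun ε hε => ?_
      obtain ⟨N, hN⟩ := exists_nat_one_div_lt hε
      obtain ⟨r, hr, hrW⟩ := hW (max k N)
      have hle : 1 / (((max k N : ℕ) : ℝ) + 1) ≤ ε := by
        refine le_trans ?_ hN.le
        gcongr
        exact le_max_right _ _
      refine ⟨r, ⟨hr.1, hr.2.trans_le hle⟩,
        (coverNum_mono (iInter₂_subset _ (le_max_left k N))).trans (hrW.trans ?_)⟩
      gcongr
    exact_mod_cast this
  · rintro _ ⟨x, ⟨-, hx⟩, rfl⟩ N
    obtain ⟨k, hk⟩ := K.exists_mem x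
    simp only [mem_iUnion, mem_iInter, not_exists, not_forall] at hx
    obtain ⟨n, hn, hxn⟩ := hx (max k N)
    exact ⟨n, (le_max_right k N).trans hn,
      hcov n x (K.subset ((le_max_left k N).trans hn) hk) hxn⟩
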